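/- Fix an integer r ≥ 2 and an integer n ≥ 0. The number of partitions λ of n whose r-quotient has 0-th component λ[0] equal to the empty partition is equal to the number of partitions of n all of whose parts are not divisible by r. -/

import Mathlib

open scoped BigOperators Classical

namespace RSF

/-! ### Partitions -/

/-- A partition, encoded as its (0-indexed, weakly decreasing, eventually zero)
sequence of parts: `f (j-1) = λ_j`. -/
def IsPartition (f : ℕ → ℕ) : Prop :=
  (∀ i j : ℕ, i ≤ j → f j ≤ f i) ∧ ∃ N : ℕ, ∀ i : ℕ, N ≤ i → f i = 0

/-- The size `|λ|` of a partition. -/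
noncomputable def psize (f : ℕ → ℕ) : ℕ := ∑ᶠ i, f i

/-- The number of (nonzero) parts of a partition. -/
noncomputable def plen (f : ℕ → ℕ) : ℕ := sInf {N : ℕ | ∀ i : ℕ, N ≤ i → f i = 0}

/-- The empty partition. -/
def emptyPart : ℕ → ℕ := fun _ => 0

/-- The transpose (conjugate) partition: `λ'_i = #{j : λ_j ≥ i}` (0-indexed). -/
noncomputable def transposeP (f : ℕ → ℕ) : ℕ → ℕ := fun i => Nat.card {j : ℕ // i < f j}

/-! ### Symmetric functions, Schur functions, Littlewood-Richardson coefficients -/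

/-- The ring of symmetric functions `Λ = ℚ[p_1, p_2, …]`; the variable `m` stands for the
power sum `p_{m+1}`. -/
abbrev SymmAlg : Type := MvPolynomial ℕ ℚ

/-- The power sum `p_j ∈ Λ` (for `j ≥ 1`). -/
noncomputable def pwr (j : ℕ) : SymmAlg := MvPolynomial.X (j - 1)

/-- Evaluation `ev_n : Λ → ℚ[x_1,…,x_n]`, sending `p_j` to `x_1^j + ⋯ + x_n^j`. -/
noncomputable def ev (n : ℕ) : SymmAlg →ₐ[ℚ] MvPolynomial (Fin n) ℚ :=
  MvPolynomial.aeval fun j => ∑ i : Fin n, MvPolynomial.X i ^ (j + 1)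

/-- The matrix `(x_i^{λ_j + n - j})_{1 ≤ i,j ≤ n}` (0-indexed). -/
noncomputable def schurMat (f : ℕ → ℕ) (n : ℕ) :
    Matrix (Fin n) (Fin n) (MvPolynomial (Fin n) ℚ) :=
  Matrix.of fun i j => MvPolynomial.X i ^ (f (j : ℕ) + (n - 1 - (j : ℕ)))

/-- `S` is the family of Schur functions: for every partition `λ` and every `n` at least the
number of parts of `λ`, `ev_n (S_λ) = det(x_i^{λ_j+n-j}) / det(x_i^{n-j})`.
(This determines `S_λ` uniquely.) -/
def IsSchurFamily (S : (ℕ → ℕ) → SymmAlg) : Prop :=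
  ∀ f : ℕ → ℕ, IsPartition f → ∀ n : ℕ, plen f ≤ n →
    ev n (S f) * (schurMat emptyPart n).det = (schurMat f n).det

/-- `LR` is the family of (multi-factor) Littlewood–Richardson coefficients of the Schur
family `S`: `S_{μ_1} ⋯ S_{μ_m} = Σ_λ LR^λ_{μ_1⋯μ_m} S_λ`. -/
def IsLRFamily (S : (ℕ → ℕ) → SymmAlg) (LR : (ℕ → ℕ) → List (ℕ → ℕ) → ℚ) : Prop :=
  (∀ lam L, ¬ IsPartition lam → LR lam L = 0) ∧
  (∀ lam L, LR lam L ≠ 0 → psize lam = (L.map psize).sum) ∧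
  (∀ L : List (ℕ → ℕ), (∀ g ∈ L, IsPartition g) →
    (L.map S).prod = ∑ᶠ lam : ℕ → ℕ, LR lam L • S lam)

/-- The ring `P^(r) = ℚ[t_j : j ≥ 1, r ∤ j]`. -/
abbrev PR (r : ℕ) : Type := MvPolynomial {j : ℕ // 0 < j ∧ ¬ r ∣ j} ℚ

/-- The homomorphism `ρ^(r) : Λ → P^(r)`, `p_j ↦ j·t_j` if `r ∤ j`, `p_j ↦ 0` if `r ∣ j`. -/
noncomputable def rho (r : ℕ) : SymmAlg →ₐ[ℚ] PR r :=
  MvPolynomial.aeval fun m =>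
    if h : r ∣ (m + 1) then 0
    else ((m + 1 : ℕ) : ℚ) • MvPolynomial.X ⟨m + 1, Nat.succ_pos m, h⟩

/-! ### Beta-sets, cores, quotients, and the `r`-sign -/

/-- The beta-set `{λ_i + N - i : 1 ≤ i ≤ N}` of a partition (first-`N` beta numbers);
it is the set of nonnegative entries of the representative of the corresponding Maya
diagram whose negative entries are exactly `{-1, -2, -3, …}` and which has `N`
nonnegative entries. -/
def betaFinset (f : ℕ → ℕ) (N : ℕ) : Finset ℕ :=
  (Finset.range N).image fun i => f i + (N - 1 - i)

/-- The elements of a finite set of naturals, listed in decreasing order. -/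
def descSort (s : Finset ℕ) : List ℕ := (s.sort (· ≤ ·)).reverse

/-- The partition whose beta-set (with `s.card` beta numbers) is `s`:
`λ_j = b_j - (card - j)` where `b_1 > b_2 > ⋯` are the elements of `s`. -/
def partOfBeta (s : Finset ℕ) : ℕ → ℕ :=
  fun j => (descSort s).getD j 0 - (s.card - 1 - j)

/-- A canonical choice of `N`: a multiple of `r` which is at least the number of parts.
(The constructions below are independent of this choice.) -/
noncomputable def defaultN (r : ℕ) (f : ℕ → ℕ) : ℕ := r * (plen f + 1)

/-- The `k`-th component `λ[k]` of the `r`-quotient of a partition. -/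
noncomputable def quotP (r : ℕ) (f : ℕ → ℕ) (k : ℕ) : ℕ → ℕ :=
  partOfBeta (((betaFinset f (defaultN r f)).filter fun b => b % r = k).image
    fun b => (b - k) / r)

/-- The `r`-core `λ_c` of a partition. -/
noncomputable def coreP (r : ℕ) (f : ℕ → ℕ) : ℕ → ℕ :=
  partOfBeta ((Finset.range r).biUnion fun k =>
    (Finset.range (((betaFinset f (defaultN r f)).filter fun b => b % r = k).card)).image
      fun j => j * r + k)

/-- The interleaved reading of the nonnegative entries: for `j = 1, 2, …` and
`k = 0, …, r-1`, the `j`-th largest beta number congruent to `k` mod `r` (if it exists). -/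
def interleaveAt (r N : ℕ) (f : ℕ → ℕ) : List ℕ :=
  (List.range N).flatMap fun j =>
    (List.range r).filterMap fun k =>
      (descSort ((betaFinset f N).filter fun b => b % r = k))[j]?

/-- The number of inversions of a list of naturals with respect to decreasing order. -/
def invCount (L : List ℕ) : ℕ :=
  ((Finset.range L.length ×ˢ Finset.range L.length).filter fun pq =>
    pq.1 < pq.2 ∧ L.getD pq.1 0 < L.getD pq.2 0).card

/-- The sign of the permutation sorting the interleaved reading of the nonnegative
entries of the chosen representative into decreasing order. -/
def deltaSignAt (r N : ℕ) (f : ℕ → ℕ) : ℤ := (-1) ^ invCount (interleaveAt r N f)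

/-- The `r`-sign `δ_r(λ)`: the sign of the permutation sorting the interleaved reading of
the nonnegative entries into decreasing order.  (It is normalized relative to the `r`-core,
so as to be independent of the choice of representative; on `r`-cores it is `+1`.) -/
noncomputable def deltaSign (r : ℕ) (f : ℕ → ℕ) : ℤ :=
  deltaSignAt r (defaultN r f) f * deltaSignAt r (defaultN r f) (coreP r f)

/-! ### Generalized Maya diagrams -/

/-- A generalized Maya diagram (as a sequence): `α_{i+1} = α_i - 1` for all large `i`. -/
def IsMaya (a : ℕ → ℤ) : Prop := ∃ N : ℕ, ∀ i : ℕ, N ≤ i → a (i + 1) = a i - 1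

/-- A strictly decreasing sequence (member of `M_d`). -/
def StrictDec (a : ℕ → ℤ) : Prop := ∀ i j : ℕ, i < j → a j < a i

/-- The action of `S_n ⊆ S_∞` on sequences, permuting the first `n` entries. -/
def permAct {n : ℕ} (σ : Equiv.Perm (Fin n)) (a : ℕ → ℤ) : ℕ → ℤ :=
  fun i => if h : i < n then a ((σ⁻¹ ⟨i, h⟩ : Fin n) : ℕ) else a i

/-- `f = λ(a)` : the partition associated with a strictly decreasing Maya sequence,
`λ_j = a_j - a_n + (j - n)` for all sufficiently large `n`. -/
def MayaCorresponds (a : ℕ → ℤ) (f : ℕ → ℕ) : Prop :=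
  ∃ N : ℕ, ∀ n : ℕ, N ≤ n → ∀ j : ℕ, j ≤ n →
    (f j : ℤ) = a j - a n + (j : ℤ) - (n : ℤ)

/-- `α + c·ε_i` : increase the `i`-th entry by `c`. -/
def addAt (a : ℕ → ℤ) (i : ℕ) (c : ℤ) : ℕ → ℤ := Function.update a i (a i + c)

/-- `SM` extends the Schur family `S` to generalized Maya diagrams:
`S_α = sgn(σ)·S_{λ(σα)}` when `σα` is strictly decreasing, and `S_α = 0` when `α` has
two equal entries. -/
def IsMayaSchur (S : (ℕ → ℕ) → SymmAlg) (SM : (ℕ → ℤ) → SymmAlg) : Prop :=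
  (∀ a : ℕ → ℤ, IsMaya a → (∃ i j : ℕ, i ≠ j ∧ a i = a j) → SM a = 0) ∧
  (∀ a : ℕ → ℤ, IsMaya a → ∀ (n : ℕ) (σ : Equiv.Perm (Fin n)) (f : ℕ → ℕ),
    StrictDec (permAct σ a) → MayaCorresponds (permAct σ a) f →
    SM a = ((Equiv.Perm.sign σ : ℤ) : ℚ) • S f)

/-- The `k`-th piece `α[k]` of the `r`-quotient of a Maya sequence (in its canonical
representative): the subsequence of entries congruent to `k` mod `r`, with
`α^{(k)}_i ↦ (α^{(k)}_i - k)/r`. -/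
noncomputable def mayaQuot (r : ℕ) (b : ℕ → ℤ) (k : ℕ) : ℕ → ℤ :=
  fun i => (b (Nat.nth (fun m => b m % (r : ℤ) = (k : ℤ)) i) - (k : ℤ)) / (r : ℤ)

/-! ### The space `U` -/

/-- Maya sequences. -/
def MSeq : Type := {a : ℕ → ℤ // IsMaya a}

/-- Two Maya sequences are equivalent iff they differ by a constant. -/
def mayaSetoid : Setoid MSeq where
  r a b := ∃ c : ℤ, ∀ i : ℕ, a.1 i = b.1 i + c
  iseqv := by
    refine ⟨fun a => ⟨0, fun i => by ring⟩, ?_, ?_⟩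
    · rintro a b ⟨c, h⟩
      exact ⟨-c, fun i => by have := h i; omega⟩
    · rintro a b c ⟨x, h⟩ ⟨y, h'⟩
      exact ⟨x + y, fun i => by have := h i; have := h' i; omega⟩

/-- The set `M` of generalized Maya diagrams. -/
def MayaCl : Type := Quotient mayaSetoid

/-- Permuting the first `n` entries preserves Maya sequences. -/
def permActM {n : ℕ} (σ : Equiv.Perm (Fin n)) (a : MSeq) : MSeq :=
  ⟨permAct σ a.1, by
    obtain ⟨N, hN⟩ := a.2
    refine ⟨max N n, fun i hi => ?_⟩
    have h1 : ¬ i < n := by omega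
    have h2 : ¬ i + 1 < n := by omega
    simp only [permAct, dif_neg h1, dif_neg h2]
    exact hN i (le_trans (le_max_left _ _) hi)⟩

/-- `α + c·ε_i` as a Maya sequence. -/
def addAtM (a : MSeq) (i : ℕ) (c : ℤ) : MSeq :=
  ⟨addAt a.1 i c, by
    obtain ⟨N, hN⟩ := a.2
    refine ⟨max N (i + 1), fun m hm => ?_⟩
    have h1 : m ≠ i := by omega
    have h2 : m + 1 ≠ i := by omega
    simp only [addAt, Function.update_apply, if_neg h1, if_neg h2]
    exact hN m (le_trans (le_max_left _ _) hm)⟩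

/-- The ℚ-vector space with basis `{u_α : α ∈ M}`. -/
abbrev FreeM : Type := MayaCl →₀ ℚ

/-- The vectors `u_{σα} - sgn(σ)·u_α`. -/
def relSet : Set FreeM :=
  {v | ∃ (a : MSeq) (n : ℕ) (σ : Equiv.Perm (Fin n)),
    v = Finsupp.single (Quotient.mk mayaSetoid (permActM σ a)) 1
      - ((Equiv.Perm.sign σ : ℤ) : ℚ) • Finsupp.single (Quotient.mk mayaSetoid a) 1}

/-- The space `U`. -/
abbrev Usp : Type := FreeM ⧸ Submodule.span ℚ relSet

/-- The image of `u_α` in `U`. -/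
noncomputable def uCl (α : MayaCl) : Usp :=
  Submodule.Quotient.mk (Finsupp.single α 1)

/-! ### Skew diagrams and rim hooks -/

/-- The cells of the skew diagram `μ/λ` (0-indexed rows and columns). -/
def cells (f g : ℕ → ℕ) : Set (ℕ × ℕ) := {c | f c.1 ≤ c.2 ∧ c.2 < g c.1}

/-- Two cells are adjacent iff they share an edge. -/
def adjCell (c d : ℕ × ℕ) : Prop :=
  (c.1 = d.1 ∧ (c.2 = d.2 + 1 ∨ d.2 = c.2 + 1)) ∨
  (c.2 = d.2 ∧ (c.1 = d.1 + 1 ∨ d.1 = c.1 + 1))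

/-- A set of cells is edgewise connected. -/
def ConnectedCells (s : Set (ℕ × ℕ)) : Prop :=
  ∀ c ∈ s, ∀ d ∈ s, Relation.ReflTransGen (fun x y => x ∈ s ∧ y ∈ s ∧ adjCell x y) c d

/-- No 2×2 block of cells. -/
def No2x2 (s : Set (ℕ × ℕ)) : Prop :=
  ¬ ∃ i j : ℕ, (i, j) ∈ s ∧ (i + 1, j) ∈ s ∧ (i, j + 1) ∈ s ∧ (i + 1, j + 1) ∈ s

/-- `μ/λ` is an `r`-hook (rim hook of length `r`). -/
def IsRHook (r : ℕ) (f g : ℕ → ℕ) : Prop :=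
  psize g = psize f + r ∧ ConnectedCells (cells f g) ∧ No2x2 (cells f g)

/-! ### Sizes and beta-sets -/

lemma psize_eq_sum_range {f : ℕ → ℕ} {N : ℕ} (h : ∀ i, N ≤ i → f i = 0) :
    psize f = ∑ i ∈ Finset.range N, f i := by
  refine finsum_eq_sum_of_support_subset f fun i hi => ?_
  by_contra hc
  exact hi (h i (by simpa using hc))

lemma IsPartition.eq_zero_of_psize_le {f : ℕ → ℕ} (hf : IsPartition f) {i : ℕ}
    (hi : psize f ≤ i) : f i = 0 := by
  by_contra h0
  obtain ⟨hd, N, hN⟩ := hf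
  have h1 : psize f = ∑ j ∈ Finset.range (max N (i + 1)), f j :=
    psize_eq_sum_range fun j hj => hN j (by omega)
  have h2 : ∑ j ∈ Finset.range (i + 1), f j ≤ ∑ j ∈ Finset.range (max N (i + 1)), f j :=
    Finset.sum_le_sum_of_subset (Finset.range_mono (le_max_right _ _))
  have h3 : (Finset.range (i + 1)).card • 1 ≤ ∑ j ∈ Finset.range (i + 1), f j :=
    Finset.card_nsmul_le_sum _ _ _ fun j hj => by
      have := hd j i (by simpa [Nat.lt_succ_iff] using hj)
      omega
  simp at h3
  omega

lemma plen_le {f : ℕ → ℕ} {N : ℕ} (h : ∀ i, N ≤ i → f i = 0) : plen f ≤ N := Nat.sInf_le h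

lemma IsPartition.eq_zero_of_plen_le {f : ℕ → ℕ} (hf : IsPartition f) {i : ℕ}
    (hi : plen f ≤ i) : f i = 0 :=
  Nat.sInf_mem (s := {N : ℕ | ∀ i : ℕ, N ≤ i → f i = 0}) hf.2 i hi

lemma mem_betaFinset {f : ℕ → ℕ} {N b : ℕ} :
    b ∈ betaFinset f N ↔ ∃ i < N, f i + (N - 1 - i) = b := by
  simp [betaFinset]

/-- The sum `0 + 1 + ⋯ + (N - 1)`. -/
def tri (N : ℕ) : ℕ := ∑ i ∈ Finset.range N, i

lemma sum_sub_eq_tri (N : ℕ) : ∑ i ∈ Finset.range N, (N - 1 - i) = tri N :=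
  Finset.sum_range_reflect (fun i => i) N

lemma betaFinset_injOn {f : ℕ → ℕ} (hf : ∀ i j : ℕ, i ≤ j → f j ≤ f i) (N : ℕ) :
    Set.InjOn (fun i => f i + (N - 1 - i)) (Finset.range N) := by
  intro i hi j hj h
  simp only [Finset.coe_range, Set.mem_Iio] at hi hj h
  rcases lt_trichotomy i j with h1 | h1 | h1
  · have := hf i j h1.le; omega
  · exact h1
  · have := hf j i h1.le; omega

lemma card_betaFinset {f : ℕ → ℕ} (hf : ∀ i j : ℕ, i ≤ j → f j ≤ f i) (N : ℕ) :
    (betaFinset f N).card = N := by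
  rw [betaFinset, Finset.card_image_of_injOn (betaFinset_injOn hf N), Finset.card_range]

lemma sum_betaFinset {f : ℕ → ℕ} (hf : IsPartition f) {N : ℕ} (hN : psize f ≤ N) :
    ∑ b ∈ betaFinset f N, b = psize f + tri N := by
  rw [betaFinset, Finset.sum_image (betaFinset_injOn hf.1 N), Finset.sum_add_distrib,
    sum_sub_eq_tri, psize_eq_sum_range fun i hi => hf.eq_zero_of_psize_le (hN.trans hi)]

lemma mem_betaFinset_of_lt {f : ℕ → ℕ} (hf : IsPartition f) {N b : ℕ}
    (hb : b + psize f < N) : b ∈ betaFinset f N :=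
  mem_betaFinset.2 ⟨N - 1 - b, by omega, by
    rw [hf.eq_zero_of_psize_le (i := N - 1 - b) (by omega)]; omega⟩

lemma orderEmbOfFin_betaFinset {f : ℕ → ℕ} (hf : ∀ i j : ℕ, i ≤ j → f j ≤ f i) (N : ℕ)
    (i : Fin N) :
    (betaFinset f N).orderEmbOfFin (card_betaFinset hf N) i = f (N - 1 - i) + i := by
  have := Finset.orderEmbOfFin_unique (card_betaFinset hf N)
    (f := fun i : Fin N => f (N - 1 - i) + i)
    (fun i => mem_betaFinset.2 ⟨N - 1 - i, by omega, by have := i.2; omega⟩)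
    (fun i j hij => by
      have h1 : (i : ℕ) < j := hij
      have := hf (N - 1 - j) (N - 1 - i) (by omega)
      show f (N - 1 - i) + i < f (N - 1 - j) + j
      omega)
  exact (congrFun this i).symm

lemma betaFinset_injective {f g : ℕ → ℕ} (hf : IsPartition f) (hg : IsPartition g) {N : ℕ}
    (hfN : psize f ≤ N) (hgN : psize g ≤ N) (h : betaFinset f N = betaFinset g N) : f = g := by
  funext i
  rcases lt_or_ge i N with hi | hi
  · have h1 := orderEmbOfFin_betaFinset hf.1 N ⟨N - 1 - i, by omega⟩
    have h2 := orderEmbOfFin_betaFinset hg.1 N ⟨N - 1 - i, by omega⟩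
    simp only [h] at h1
    rw [h1] at h2
    simp only [show N - 1 - (N - 1 - i) = i by omega] at h2
    omega
  · rw [hf.eq_zero_of_psize_le (hfN.trans hi), hg.eq_zero_of_psize_le (hgN.trans hi)]

lemma exists_betaFinset_eq (T : Finset ℕ) :
    ∃ f : ℕ → ℕ, IsPartition f ∧ (∀ i, T.card ≤ i → f i = 0) ∧ betaFinset f T.card = T := by
  set N := T.card with hN
  have he : ∀ i j : Fin N, i ≤ j →
      T.orderEmbOfFin rfl i + (j - i : ℕ) ≤ T.orderEmbOfFin rfl j := by
    rintro ⟨i, hi⟩ ⟨j, hj⟩ hij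
    obtain ⟨k, rfl⟩ := Nat.exists_eq_add_of_le (show i ≤ j from hij)
    clear hij
    induction k with
    | zero => simp
    | succ k ih =>
      have h1 := ih (by omega)
      have h2 : T.orderEmbOfFin rfl ⟨i + k, by omega⟩ < T.orderEmbOfFin rfl ⟨i + (k + 1), hj⟩ :=
        (T.orderEmbOfFin rfl).strictMono (by simp [Fin.lt_def])
      simp only at h1 ⊢
      omega
  have h0 : ∀ i : Fin N, (i : ℕ) ≤ T.orderEmbOfFin rfl i := fun i => by
    have := he ⟨0, by have := i.2; omega⟩ i (by simp [Fin.le_def])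
    simp only at this
    omega
  let f : ℕ → ℕ := fun i =>
    if h : i < N then T.orderEmbOfFin rfl ⟨N - 1 - i, by omega⟩ - (N - 1 - i) else 0
  have hz : ∀ i, N ≤ i → f i = 0 := fun i hi => dif_neg (by omega)
  refine ⟨f, ⟨fun i j hij => ?_, N, hz⟩, hz, ?_⟩
  · rcases lt_or_ge j N with hj | hj
    · have := he ⟨N - 1 - j, by omega⟩ ⟨N - 1 - i, by omega⟩ (by simp only [Fin.mk_le_mk]; omega)
      simp only [f, dif_pos hj, dif_pos (lt_of_le_of_lt hij hj)]
      simp only at this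
      omega
    · simp [hz j hj]
  · ext b
    rw [mem_betaFinset]
    constructor
    · rintro ⟨i, hi, rfl⟩
      have := h0 ⟨N - 1 - i, by omega⟩
      simp only [f, dif_pos hi]
      rw [Nat.sub_add_cancel this]
      exact T.orderEmbOfFin_mem rfl _
    · intro hb
      rw [← Finset.mem_coe, ← Finset.range_orderEmbOfFin T rfl] at hb
      obtain ⟨i, rfl⟩ := hb
      have hi : (i : ℕ) < N := i.2
      refine ⟨N - 1 - i, by omega, ?_⟩
      have h2 : N - 1 - (N - 1 - i : ℕ) = i := by omega
      simp only [f, dif_pos (show N - 1 - (i : ℕ) < N by omega), h2]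
      exact Nat.sub_add_cancel (h0 i)

lemma exists_betaFinset_eq_of_sum {T : Finset ℕ} {n : ℕ} (h : ∑ b ∈ T, b = n + tri T.card) :
    ∃ f : ℕ → ℕ, IsPartition f ∧ psize f = n ∧ betaFinset f T.card = T := by
  obtain ⟨f, hf, hz, hT⟩ := exists_betaFinset_eq T
  refine ⟨f, hf, ?_, hT⟩
  conv_lhs at h => rw [← hT]
  rw [betaFinset, Finset.sum_image (betaFinset_injOn hf.1 _), Finset.sum_add_distrib,
    sum_sub_eq_tri, ← psize_eq_sum_range hz] at h
  omega

lemma tri_card_le_sum (T : Finset ℕ) : tri T.card ≤ ∑ b ∈ T, b := by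
  obtain ⟨f, hf, hz, hT⟩ := exists_betaFinset_eq T
  conv_rhs => rw [← hT]
  rw [betaFinset, Finset.sum_image (betaFinset_injOn hf.1 _), Finset.sum_add_distrib,
    sum_sub_eq_tri]
  omega

/-- Partitions of `n` satisfying `p` correspond to beta-sets of any fixed cardinality `N ≥ n`. -/
noncomputable def betaEquiv {n N : ℕ} (hN : n ≤ N) (p : (ℕ → ℕ) → Prop) (q : Finset ℕ → Prop)
    (hpq : ∀ f, IsPartition f → psize f = n → (p f ↔ q (betaFinset f N))) :
    {f : ℕ → ℕ // IsPartition f ∧ psize f = n ∧ p f} ≃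
      {T : Finset ℕ // T.card = N ∧ ∑ b ∈ T, b = n + tri N ∧ q T} :=
  Equiv.ofBijective
    (fun f => ⟨betaFinset f.1 N, card_betaFinset f.2.1.1 N, by
      rw [sum_betaFinset f.2.1 (by rw [f.2.2.1]; exact hN), f.2.2.1],
      (hpq f.1 f.2.1 f.2.2.1).1 f.2.2.2⟩) (by
    constructor
    · rintro ⟨f, hf, hfn, hpf⟩ ⟨g, hg, hgn, hpg⟩ h
      exact Subtype.ext (betaFinset_injective hf hg (hfn.trans_le hN) (hgn.trans_le hN)
        (congrArg Subtype.val h))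
    · rintro ⟨T, rfl, hs, hq⟩
      obtain ⟨f, hf, hfn, hT⟩ := exists_betaFinset_eq_of_sum hs
      exact ⟨⟨f, hf, hfn, (hpq f hf hfn).2 (by rwa [hT])⟩, Subtype.ext hT⟩)

/-! ### The zeroth component of the quotient -/

lemma partOfBeta_eq_emptyPart_iff (s : Finset ℕ) :
    partOfBeta s = emptyPart ↔ s = Finset.range s.card := by
  constructor
  · intro h
    refine Finset.eq_of_subset_of_card_le (fun b hb => ?_) (by simp)
    have h0 := congrFun h 0
    have hpos : 0 < (descSort s).length := by
      simpa [descSort] using Finset.card_pos.2 ⟨b, hb⟩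
    have hb' : b ∈ descSort s := by simpa [descSort] using hb
    obtain ⟨i, hi, rfl⟩ := List.getElem_of_mem hb'
    have hs : (descSort s).SortedGE := by
      simpa [descSort] using (s.sortedLT_sort).sortedLE
    have hle : (descSort s)[i] ≤ (descSort s)[0] :=
      List.sortedGE_iff_getElem_ge_getElem_of_le.1 hs (Nat.zero_le i)
    have hc : 0 < s.card := Finset.card_pos.2 ⟨_, hb⟩
    simp only [partOfBeta, emptyPart, List.getD_eq_getElem _ _ hpos] at h0
    rw [Finset.mem_range]
    omega
  · intro h
    generalize s.card = c at h
    subst h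
    funext j
    simp only [partOfBeta, emptyPart, descSort, Finset.sort_range, Finset.card_range]
    rcases lt_or_ge j c with hj | hj
    · rw [List.getD_eq_getElem _ _ (by simpa using hj)]
      simp
    · rw [List.getD_eq_default _ _ (by simpa using hj)]
      simp

lemma eq_range_card_iff (s : Finset ℕ) :
    s = Finset.range s.card ↔ ∀ b, b + 1 ∈ s → b ∈ s := by
  constructor
  · intro h b hb
    rw [h, Finset.mem_range] at hb ⊢
    omega
  · intro h
    have hdown : ∀ k b, b + k ∈ s → b ∈ s := by
      intro k
      induction k with
      | zero => exact fun b hb => hb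
      | succ k ih => exact fun b hb => ih b (h _ hb)
    refine Finset.eq_of_subset_of_card_le (fun b hb => ?_) (by simp)
    have : Finset.range (b + 1) ⊆ s := fun a ha => by
      rw [Finset.mem_range] at ha
      exact hdown (b - a) a (by rwa [show a + (b - a) = b by omega])
    have := Finset.card_le_card this
    rw [Finset.card_range] at this
    exact Finset.mem_range.2 this

/-- The positions of the beads of `T` lying on the zeroth runner of the `r`-abacus. -/
def zeroRunner (r : ℕ) (T : Finset ℕ) : Finset ℕ :=
  (T.filter fun b => b % r = 0).image fun b => (b - 0) / r

lemma mem_zeroRunner {r : ℕ} (hr : 0 < r) {T : Finset ℕ} {b : ℕ} :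
    b ∈ zeroRunner r T ↔ r * b ∈ T := by
  simp only [zeroRunner, Finset.mem_image, Finset.mem_filter, Nat.sub_zero]
  constructor
  · rintro ⟨a, ⟨ha, h0⟩, rfl⟩
    rwa [Nat.mul_div_cancel' (Nat.dvd_of_mod_eq_zero h0)]
  · exact fun h => ⟨r * b, ⟨h, by simp⟩, Nat.mul_div_cancel_left b hr⟩

/-- The zeroth runner of the `r`-abacus of `T` has no gaps. -/
def ZeroRunnerPacked (r : ℕ) (T : Finset ℕ) : Prop :=
  zeroRunner r T = Finset.range (zeroRunner r T).card

lemma zeroRunnerPacked_iff {r : ℕ} (hr : 0 < r) (T : Finset ℕ) :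
    ZeroRunnerPacked r T ↔ ∀ b, r * (b + 1) ∈ T → r * b ∈ T := by
  simp only [ZeroRunnerPacked, eq_range_card_iff, mem_zeroRunner hr]

lemma add_mem_betaFinset_add {f : ℕ → ℕ} {N k b : ℕ} (hN : ∀ i, N ≤ i → f i = 0) :
    b + k ∈ betaFinset f (N + k) ↔ b ∈ betaFinset f N := by
  simp only [mem_betaFinset]
  constructor
  · rintro ⟨i, hi, h⟩
    rcases lt_or_ge i N with hiN | hiN
    · exact ⟨i, hiN, by omega⟩
    · have := hN i hiN; omega
  · rintro ⟨i, hi, h⟩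
    exact ⟨i, by omega, by omega⟩

lemma mem_betaFinset_add_of_lt {f : ℕ → ℕ} {N k b : ℕ} (hN : ∀ i, N ≤ i → f i = 0)
    (hb : b < k) : b ∈ betaFinset f (N + k) :=
  mem_betaFinset.2 ⟨N + k - 1 - b, by omega, by rw [hN _ (by omega)]; omega⟩

lemma zeroRunnerPacked_betaFinset_add {r : ℕ} (hr : 0 < r) {f : ℕ → ℕ} {N : ℕ}
    (hN : ∀ i, N ≤ i → f i = 0) (k : ℕ) :
    ZeroRunnerPacked r (betaFinset f (N + r * k)) ↔ ZeroRunnerPacked r (betaFinset f N) := by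
  rw [zeroRunnerPacked_iff hr, zeroRunnerPacked_iff hr]
  constructor
  · intro h b hb
    rw [← add_mem_betaFinset_add (k := r * k) hN, ← mul_add] at hb ⊢
    exact h _ (by rwa [add_right_comm])
  · intro h b hb
    rcases lt_or_ge b k with hbk | hbk
    · exact mem_betaFinset_add_of_lt hN (Nat.mul_lt_mul_of_pos_left hbk hr)
    · obtain ⟨c, rfl⟩ := Nat.exists_eq_add_of_le' hbk
      rw [mul_add, add_mem_betaFinset_add hN]
      rw [add_right_comm, mul_add, add_mem_betaFinset_add hN] at hb
      exact h _ hb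

lemma quotP_zero_eq_emptyPart_iff {r : ℕ} (hr : 0 < r) {f : ℕ → ℕ} (hf : IsPartition f) {K : ℕ}
    (hK : psize f < K) : quotP r f 0 = emptyPart ↔ ZeroRunnerPacked r (betaFinset f (r * K)) := by
  have hle : plen f + 1 ≤ K :=
    (Nat.succ_le_succ (plen_le fun i hi => hf.eq_zero_of_psize_le hi)).trans hK
  have hz : ∀ i, r * (plen f + 1) ≤ i → f i = 0 := fun i hi => by
    have := Nat.le_mul_of_pos_left (plen f + 1) hr
    exact hf.eq_zero_of_plen_le (by omega)
  obtain ⟨k, rfl⟩ := Nat.exists_eq_add_of_le hle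
  rw [mul_add, zeroRunnerPacked_betaFinset_add hr hz]
  exact partOfBeta_eq_emptyPart_iff _

/-! ### Replacing the zeroth runner -/

/-- The elements of `T` lying on a nonzero runner of the `r`-abacus. -/
def otherRunners (r : ℕ) (T : Finset ℕ) : Finset ℕ := T.filter fun b => ¬ r ∣ b

/-- The bead set with beads `R` on the nonzero runners and `S` on the zeroth one. -/
def glue (r : ℕ) (R S : Finset ℕ) : Finset ℕ := R ∪ S.image (r * ·)

lemma mem_glue {r : ℕ} {R S : Finset ℕ} {b : ℕ} :
    b ∈ glue r R S ↔ b ∈ R ∨ ∃ a ∈ S, r * a = b := by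
  simp [glue]

lemma not_dvd_of_mem_otherRunners {r : ℕ} {T : Finset ℕ} : ∀ b ∈ otherRunners r T, ¬ r ∣ b :=
  fun _ hb => (Finset.mem_filter.1 hb).2

lemma glue_otherRunners_zeroRunner {r : ℕ} (hr : 0 < r) (T : Finset ℕ) :
    glue r (otherRunners r T) (zeroRunner r T) = T := by
  ext b
  simp only [mem_glue, otherRunners, Finset.mem_filter, mem_zeroRunner hr]
  constructor
  · rintro (h | ⟨a, h, rfl⟩)
    · exact h.1
    · exact h
  · intro h
    by_cases hd : r ∣ b
    · obtain ⟨a, rfl⟩ := hd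
      exact Or.inr ⟨a, h, rfl⟩
    · exact Or.inl ⟨h, hd⟩

lemma zeroRunner_glue {r : ℕ} (hr : 0 < r) {R : Finset ℕ} (hR : ∀ b ∈ R, ¬ r ∣ b)
    (S : Finset ℕ) : zeroRunner r (glue r R S) = S := by
  ext b
  rw [mem_zeroRunner hr, mem_glue]
  constructor
  · rintro (h | ⟨a, h, hab⟩)
    · exact absurd (Dvd.intro _ rfl) (hR _ h)
    · rwa [← Nat.eq_of_mul_eq_mul_left hr hab]
  · exact fun h => Or.inr ⟨b, h, rfl⟩

lemma otherRunners_glue {r : ℕ} {R : Finset ℕ} (hR : ∀ b ∈ R, ¬ r ∣ b) (S : Finset ℕ) :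
    otherRunners r (glue r R S) = R := by
  ext b
  rw [otherRunners, Finset.mem_filter, mem_glue]
  constructor
  · rintro ⟨h | ⟨a, -, rfl⟩, h'⟩
    · exact h
    · exact absurd (Dvd.intro _ rfl) h'
  · exact fun h => ⟨Or.inl h, hR b h⟩

lemma disjoint_image_mul {r : ℕ} {R : Finset ℕ} (hR : ∀ b ∈ R, ¬ r ∣ b) (S : Finset ℕ) :
    Disjoint R (S.image (r * ·)) :=
  Finset.disjoint_left.2 fun b hb hb' => by
    obtain ⟨a, -, rfl⟩ := Finset.mem_image.1 hb'
    exact hR _ hb (Dvd.intro _ rfl)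

lemma card_glue {r : ℕ} (hr : 0 < r) {R : Finset ℕ} (hR : ∀ b ∈ R, ¬ r ∣ b) (S : Finset ℕ) :
    (glue r R S).card = R.card + S.card := by
  rw [glue, Finset.card_union_of_disjoint (disjoint_image_mul hR S),
    Finset.card_image_of_injective _ fun a b h => Nat.eq_of_mul_eq_mul_left hr h]

lemma sum_glue {r : ℕ} (hr : 0 < r) {R : Finset ℕ} (hR : ∀ b ∈ R, ¬ r ∣ b) (S : Finset ℕ) :
    ∑ b ∈ glue r R S, b = ∑ b ∈ R, b + r * ∑ b ∈ S, b := by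
  rw [glue, Finset.sum_union (disjoint_image_mul hR S),
    Finset.sum_image fun a _ b _ h => Nat.eq_of_mul_eq_mul_left hr h, Finset.mul_sum]

lemma card_otherRunners_add {r : ℕ} (hr : 0 < r) (T : Finset ℕ) :
    (otherRunners r T).card + (zeroRunner r T).card = T.card := by
  conv_rhs => rw [← glue_otherRunners_zeroRunner hr T]
  rw [card_glue hr not_dvd_of_mem_otherRunners]

lemma sum_otherRunners_add {r : ℕ} (hr : 0 < r) (T : Finset ℕ) :
    ∑ b ∈ otherRunners r T, b + r * ∑ b ∈ zeroRunner r T, b = ∑ b ∈ T, b := by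
  conv_rhs => rw [← glue_otherRunners_zeroRunner hr T]
  rw [sum_glue hr not_dvd_of_mem_otherRunners]

/-- The sets of beads on the nonzero runners whose completion to `N` beads by a packed zeroth
runner represents a partition of `n - r * m`. -/
def Outer (r N n m : ℕ) : Type :=
  {R : Finset ℕ // (∀ b ∈ R, ¬ r ∣ b) ∧ R.card ≤ N ∧
    ∑ b ∈ R, b + r * (m + tri (N - R.card)) = n + tri N}

/-- The bead sets with `N` beads representing a partition of `n`. -/
def Beads (N n : ℕ) : Type := {T : Finset ℕ // T.card = N ∧ ∑ b ∈ T, b = n + tri N}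

lemma sum_range_eq_tri (N : ℕ) : ∑ b ∈ Finset.range N, b = tri N := rfl

lemma Outer.tri_le {r N n m : ℕ} (hr : 0 < r) (R : Outer r N n m) :
    tri N ≤ ∑ b ∈ R.1, b + r * tri (N - R.1.card) := by
  obtain ⟨R, hR, hc, hs⟩ := R
  have h := tri_card_le_sum (glue r R (Finset.range (N - R.card)))
  rwa [card_glue hr hR, sum_glue hr hR, Finset.card_range, Nat.add_sub_cancel' hc,
    sum_range_eq_tri] at h

/-- Completion by a packed zeroth runner. -/
def outerEquiv {r N n m : ℕ} (hr : 0 < r) (hm : r * m ≤ n) :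
    Outer r N n m ≃ {U : Finset ℕ // U.card = N ∧ ∑ b ∈ U, b = (n - r * m) + tri N ∧
      ZeroRunnerPacked r U} where
  toFun R := ⟨glue r R.1 (Finset.range (N - R.1.card)), by
    rw [card_glue hr R.2.1, Finset.card_range, Nat.add_sub_cancel' R.2.2.1], by
    have h := R.2.2.2
    rw [sum_glue hr R.2.1, sum_range_eq_tri]
    rw [mul_add] at h
    omega, by
    rw [ZeroRunnerPacked, zeroRunner_glue hr R.2.1, Finset.card_range]⟩
  invFun U := ⟨otherRunners r U.1, not_dvd_of_mem_otherRunners,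
    (Finset.card_filter_le _ _).trans U.2.1.le, by
    have hc := card_otherRunners_add hr U.1
    have hs := sum_otherRunners_add hr U.1
    rw [U.2.1] at hc
    rw [U.2.2.1, U.2.2.2, sum_range_eq_tri] at hs
    rw [show N - (otherRunners r U.1).card = (zeroRunner r U.1).card by omega, mul_add]
    omega⟩
  left_inv R := Subtype.ext (otherRunners_glue R.2.1 _)
  right_inv U := Subtype.ext <| by
    have hc := card_otherRunners_add hr U.1
    rw [U.2.1] at hc
    show glue r (otherRunners r U.1) (Finset.range (N - (otherRunners r U.1).card)) = U.1
    rw [show N - (otherRunners r U.1).card = (zeroRunner r U.1).card by omega, ← U.2.2.2,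
      glue_otherRunners_zeroRunner hr]

/-- Splitting a bead set into its nonzero runners and its zeroth runner. -/
noncomputable def beadsEquiv {r : ℕ} (hr : 0 < r) (N n : ℕ) :
    Beads N n ≃ Σ m : Fin (n / r + 1), Σ R : Outer r N n m, Beads (N - R.1.card) m :=
  (Equiv.ofBijective
    (fun x : Σ m : Fin (n / r + 1), Σ R : Outer r N n m, Beads (N - R.1.card) m =>
      (⟨glue r x.2.1.1 x.2.2.1, by
        rw [card_glue hr x.2.1.2.1, x.2.2.2.1, Nat.add_sub_cancel' x.2.1.2.2.1], by
        rw [sum_glue hr x.2.1.2.1, x.2.2.2.2, x.2.1.2.2.2]⟩ : Beads N n)) (by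
    constructor
    · rintro ⟨m, ⟨R, hR, hc, hs⟩, S, hSc, hSs⟩ ⟨m', ⟨R', hR', hc', hs'⟩, S', hSc', hSs'⟩ h
      have h : glue r R S = glue r R' S' := congrArg Subtype.val h
      have h1 : R = R' := by rw [← otherRunners_glue hR S, h, otherRunners_glue hR']
      have h2 : S = S' := by rw [← zeroRunner_glue hr hR S, h, zeroRunner_glue hr hR']
      subst h1 h2
      have h3 : m = m' := Fin.ext (Nat.add_right_cancel (hSs.symm.trans hSs'))
      subst h3
      rfl
    · rintro ⟨T, hc, hs⟩
      have hc' := card_otherRunners_add hr T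
      have hs' := sum_otherRunners_add hr T
      rw [hc] at hc'
      rw [hs] at hs'
      obtain ⟨m, hm⟩ := Nat.exists_eq_add_of_le' (tri_card_le_sum (zeroRunner r T))
      rw [show (zeroRunner r T).card = N - (otherRunners r T).card by omega] at hm
      rw [hm] at hs'
      let R : Outer r N n m := ⟨otherRunners r T, not_dvd_of_mem_otherRunners, by omega, hs'⟩
      have hRm := R.tri_le hr
      have hmn : m ≤ n / r := by
        rw [Nat.le_div_iff_mul_le hr, mul_comm]
        have : ∑ b ∈ R.1, b + r * (m + tri (N - R.1.card)) = n + tri N := hs'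
        rw [mul_add] at this
        omega
      exact ⟨⟨⟨m, by omega⟩, R, zeroRunner r T,
        show (zeroRunner r T).card = N - (otherRunners r T).card by omega, hm⟩,
        Subtype.ext (glue_otherRunners_zeroRunner hr T)⟩)).symm

/-- The partitions of `n`. -/
def Partitions (n : ℕ) : Type := {f : ℕ → ℕ // IsPartition f ∧ psize f = n}

/-- A partition of `n` corresponds to its beta-set with `N ≥ n` elements. -/
noncomputable def partitionsEquivBeads {n N : ℕ} (hN : n ≤ N) : Partitions n ≃ Beads N n :=
  ((Equiv.subtypeEquivRight fun f => by simp).trans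
    (betaEquiv hN (fun _ => True) (fun _ => True) fun _ _ _ => Iff.rfl)).trans
    (Equiv.subtypeEquivRight fun T => by simp)

/-- The partitions of `n` whose `r`-quotient has empty zeroth component. -/
def EmptyZero (r n : ℕ) : Type :=
  {f : ℕ → ℕ // IsPartition f ∧ psize f = n ∧ quotP r f 0 = emptyPart}

/-- Beta-sets with packed zeroth runner are determined by their nonzero runners. -/
noncomputable def emptyZeroEquivOuter {r n m K : ℕ} (hr : 0 < r) (hm : r * m ≤ n) (hK : n < K) :
    EmptyZero r (n - r * m) ≃ Outer r (r * K) n m :=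
  (betaEquiv (by have := Nat.le_mul_of_pos_left K hr; omega) _ (ZeroRunnerPacked r)
    fun _ hf hfn => quotP_zero_eq_emptyPart_iff hr hf (by omega)).trans (outerEquiv hr hm).symm

lemma Outer.le_card {r n m K : ℕ} (hr : 0 < r) (hm : r * m ≤ n) (hK : 2 * n < K)
    (R : Outer r (r * K) n m) : m ≤ r * K - R.1.card := by
  have hmn : m ≤ n := (Nat.le_mul_of_pos_left m hr).trans hm
  obtain ⟨U, hU⟩ : ∃ U, U = outerEquiv hr hm R := ⟨_, rfl⟩
  obtain ⟨f, hf, hfn, hfU⟩ := exists_betaFinset_eq_of_sum (T := U.1) (n := n - r * m) (by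
    rw [U.2.1]; exact U.2.2.1)
  rw [U.2.1, hU] at hfU
  change betaFinset f (r * K) = glue r R.1 (Finset.range (r * K - R.1.card)) at hfU
  have hb : r * m ∈ betaFinset f (r * K) := by
    refine mem_betaFinset_of_lt hf ?_
    have := Nat.le_mul_of_pos_left K hr
    omega
  rw [hfU, ← mem_zeroRunner hr, zeroRunner_glue hr R.2.1, Finset.mem_range] at hb
  exact hb.le

/-- Splitting off the zeroth component of the `r`-quotient. -/
noncomputable def partitionsEquivEmptyZero {r : ℕ} (hr : 0 < r) (n : ℕ) :
    Partitions n ≃ Σ m : Fin (n / r + 1), EmptyZero r (n - r * m) × Partitions m :=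
  ((partitionsEquivBeads (N := r * (2 * n + 1)) (by
    have := Nat.le_mul_of_pos_left (2 * n + 1) hr; omega)).trans (beadsEquiv hr _ n)).trans <|
  Equiv.sigmaCongrRight fun m =>
    have hm : r * m ≤ n := (Nat.mul_le_mul_left r (Nat.lt_succ_iff.1 m.2)).trans
      (Nat.mul_div_le n r)
    (Equiv.sigmaCongrRight fun R =>
      (partitionsEquivBeads (R.le_card hr hm (Nat.lt_succ_self _))).symm).trans <|
    (Equiv.sigmaEquivProd _ _).trans <|
    Equiv.prodCongr (emptyZeroEquivOuter hr hm (by omega)).symm (Equiv.refl _)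

/-! ### Removing the parts divisible by `r` -/

/-- The multiset of nonzero values among `f 0, …, f (n - 1)`. -/
def nonzeroParts (f : ℕ → ℕ) (n : ℕ) : Multiset ℕ :=
  ((Multiset.range n).map f).filter (· ≠ 0)

lemma mem_nonzeroParts {f : ℕ → ℕ} {n x : ℕ} :
    x ∈ nonzeroParts f n ↔ (∃ i < n, f i = x) ∧ x ≠ 0 := by
  simp [nonzeroParts]

lemma filter_ne_zero_add_replicate (s : Multiset ℕ) :
    s.filter (· ≠ 0) + Multiset.replicate (s.card - (s.filter (· ≠ 0)).card) 0 = s := by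
  have h : s.filter (· ≠ 0) + s.filter (fun x => ¬ x ≠ 0) = s := Multiset.filter_add_not _ s
  have h' : s.filter (fun x => ¬ x ≠ 0) = Multiset.replicate (s.count 0) 0 := by
    simp only [not_not]
    exact Multiset.filter_eq' s 0
  rw [h'] at h
  have hc := congrArg Multiset.card h
  rw [Multiset.card_add, Multiset.card_replicate] at hc
  rwa [show s.card - (s.filter (· ≠ 0)).card = s.count 0 by omega]

lemma sum_nonzeroParts {f : ℕ → ℕ} (hf : IsPartition f) {n : ℕ} (hn : psize f = n) :
    (nonzeroParts f n).sum = n := by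
  subst hn
  have h := congrArg Multiset.sum
    (filter_ne_zero_add_replicate ((Multiset.range (psize f)).map f))
  rw [Multiset.sum_add, Multiset.sum_replicate, smul_zero, add_zero] at h
  conv_rhs => rw [psize_eq_sum_range (N := psize f) fun i hi => hf.eq_zero_of_psize_le hi]
  exact h

lemma pairwise_ge_map_range {f : ℕ → ℕ} (hf : ∀ i j : ℕ, i ≤ j → f j ≤ f i) (n : ℕ) :
    ((List.range n).map f).Pairwise (· ≥ ·) := by
  rw [List.pairwise_map]
  exact List.pairwise_lt_range.imp fun h => hf _ _ h.le

lemma nonzeroParts_injective {f g : ℕ → ℕ} {n : ℕ} (hf : IsPartition f) (hg : IsPartition g)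
    (hfn : psize f ≤ n) (hgn : psize g ≤ n) (h : nonzeroParts f n = nonzeroParts g n) :
    f = g := by
  have h1 : (Multiset.range n).map f = (Multiset.range n).map g := by
    rw [← filter_ne_zero_add_replicate ((Multiset.range n).map f),
      ← filter_ne_zero_add_replicate ((Multiset.range n).map g)]
    change nonzeroParts f n + Multiset.replicate (_ - (nonzeroParts f n).card) 0 =
      nonzeroParts g n + Multiset.replicate (_ - (nonzeroParts g n).card) 0
    rw [h, Multiset.card_map, Multiset.card_map]
  have h2 : (List.range n).map f = (List.range n).map g :=
    List.Perm.eq_of_pairwise' (pairwise_ge_map_range hf.1 n) (pairwise_ge_map_range hg.1 n)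
      (Multiset.coe_eq_coe.1 h1)
  funext i
  rcases lt_or_ge i n with hi | hi
  · exact List.map_inj_left.1 h2 i (List.mem_range.2 hi)
  · rw [hf.eq_zero_of_psize_le (hfn.trans hi), hg.eq_zero_of_psize_le (hgn.trans hi)]

lemma exists_nonzeroParts_eq {s : Multiset ℕ} (hs : ∀ x ∈ s, 0 < x) :
    ∃ f : ℕ → ℕ, IsPartition f ∧ psize f = s.sum ∧ nonzeroParts f s.sum = s := by
  have hsort : (s.sort (· ≥ ·)).Pairwise (· ≥ ·) := s.pairwise_sort _
  have hperm : ((s.sort (· ≥ ·) : List ℕ) : Multiset ℕ) = s := s.sort_eq _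
  generalize s.sort (· ≥ ·) = l at hsort hperm
  subst hperm
  rw [← List.sortedGE_iff_pairwise] at hsort
  have hlen : l.length ≤ l.sum := by
    simpa using List.card_nsmul_le_sum l 1 fun x hx => hs x hx
  have hz : ∀ i, l.length ≤ i → l.getD i 0 = 0 := fun i hi => List.getD_eq_default _ _ hi
  have hmap : (List.range l.length).map (fun i => l.getD i 0) = l :=
    List.ext_getElem (by simp) fun i _ hi => by simp [List.getElem?_eq_getElem hi]
  refine ⟨fun i => l.getD i 0, ⟨fun i j hij => ?_, _, hz⟩, ?_, ?_⟩
  · rcases lt_or_ge j l.length with hj | hj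
    · simp only [List.getD_eq_getElem _ _ hj, List.getD_eq_getElem _ _ (hij.trans_lt hj)]
      exact List.sortedGE_iff_getElem_ge_getElem_of_le.1 hsort hij
    · simp only [hz j hj, Nat.zero_le]
  · rw [psize_eq_sum_range hz, Multiset.sum_coe]
    conv_rhs => rw [← hmap]
    rfl
  · rw [Multiset.sum_coe]
    obtain ⟨k, hk⟩ := Nat.exists_eq_add_of_le hlen
    have h2 : (List.range l.sum).map (fun i => l.getD i 0) = l ++ List.replicate k 0 := by
      rw [hk, List.range_add, List.map_append, hmap, List.map_map]
      congr 1
      exact List.eq_replicate_iff.2 ⟨by simp, by simp⟩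
    have h3 : (Multiset.range l.sum).map (fun i => l.getD i 0) =
        (l : Multiset ℕ) + Multiset.replicate k 0 := congrArg _ h2
    rw [nonzeroParts, h3, Multiset.filter_add,
      Multiset.filter_eq_self.2 fun x hx => (hs x hx).ne',
      Multiset.filter_eq_nil.2 fun x hx => by simp [Multiset.eq_of_mem_replicate hx], add_zero]

/-- Multisets of positive integers satisfying `p` with sum `n`. -/
def PartMultisets (p : ℕ → Prop) (n : ℕ) : Type :=
  {s : Multiset ℕ // (∀ x ∈ s, 0 < x ∧ p x) ∧ s.sum = n}

/-- A partition corresponds to the multiset of its nonzero parts. -/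
noncomputable def partMultisetsEquiv (p : ℕ → Prop) (n : ℕ) :
    {f : ℕ → ℕ // IsPartition f ∧ psize f = n ∧ ∀ i, f i ≠ 0 → p (f i)} ≃
      PartMultisets p n :=
  Equiv.ofBijective
    (fun f => ⟨nonzeroParts f.1 n, fun x hx => by
      obtain ⟨⟨i, -, rfl⟩, h0⟩ := mem_nonzeroParts.1 hx
      exact ⟨Nat.pos_of_ne_zero h0, f.2.2.2 i h0⟩, sum_nonzeroParts f.2.1 f.2.2.1⟩) (by
    constructor
    · rintro ⟨f, hf, hfn, hpf⟩ ⟨g, hg, hgn, hpg⟩ h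
      exact Subtype.ext (nonzeroParts_injective hf hg hfn.le hgn.le (congrArg Subtype.val h))
    · rintro ⟨s, hs, rfl⟩
      obtain ⟨f, hf, hfn, hfs⟩ := exists_nonzeroParts_eq fun x hx => (hs x hx).1
      refine ⟨⟨f, hf, hfn, fun i hi => ?_⟩, Subtype.ext hfs⟩
      refine (hs (f i) ?_).2
      rw [← hfs, mem_nonzeroParts]
      refine ⟨⟨i, ?_, rfl⟩, hi⟩
      by_contra hc
      exact hi (hf.eq_zero_of_psize_le (by omega)))

/-- Splitting a partition into its parts not divisible by `r` and those divisible by `r`. -/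
noncomputable def partMultisetsSplit {r : ℕ} (hr : 0 < r) (n : ℕ) :
    PartMultisets (fun _ => True) n ≃ Σ m : Fin (n / r + 1),
      PartMultisets (fun x => ¬ r ∣ x) (n - r * m) × PartMultisets (fun _ => True) m :=
  have hle : ∀ m : Fin (n / r + 1), r * m ≤ n := fun m =>
    (Nat.mul_le_mul_left r (Nat.lt_succ_iff.1 m.2)).trans (Nat.mul_div_le n r)
  (Equiv.ofBijective
    (fun x : Σ m : Fin (n / r + 1),
      PartMultisets (fun x => ¬ r ∣ x) (n - r * m) × PartMultisets (fun _ => True) m =>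
      (⟨x.2.1.1 + x.2.2.1.map (r * ·), fun y hy => by
        refine ⟨?_, trivial⟩
        rcases Multiset.mem_add.1 hy with hy | hy
        · exact (x.2.1.2.1 y hy).1
        · obtain ⟨a, ha, rfl⟩ := Multiset.mem_map.1 hy
          exact Nat.mul_pos hr (x.2.2.2.1 a ha).1, by
        rw [Multiset.sum_add, Multiset.sum_map_mul_left, Multiset.map_id', x.2.1.2.2, x.2.2.2.2,
          Nat.sub_add_cancel (hle x.1)]⟩ : PartMultisets (fun _ => True) n)) (by
    constructor
    · rintro ⟨m, ⟨s, hs, hsn⟩, t, ht, htm⟩ ⟨m', ⟨s', hs', hsn'⟩, t', ht', htm'⟩ h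
      have h : s + t.map (r * ·) = s' + t'.map (r * ·) := congrArg Subtype.val h
      have key : ∀ s t : Multiset ℕ, (∀ x ∈ s, 0 < x ∧ ¬ r ∣ x) →
          (s + t.map (r * ·)).filter (fun x => ¬ r ∣ x) = s := fun s t hs => by
        rw [Multiset.filter_add, Multiset.filter_eq_self.2 fun x hx => (hs x hx).2,
          Multiset.filter_eq_nil.2 fun x hx => ?_, add_zero]
        obtain ⟨a, -, rfl⟩ := Multiset.mem_map.1 hx
        exact not_not.2 (Dvd.intro _ rfl)
      have h1 : s = s' := by rw [← key s t hs, h, key s' t' hs']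
      subst h1
      have h2 : t = t' := Multiset.map_injective
        (fun a b h => Nat.eq_of_mul_eq_mul_left hr h) (add_left_cancel h)
      subst h2
      have h3 : m = m' := Fin.ext (htm.symm.trans htm')
      subst h3
      rfl
    · rintro ⟨s, hs, rfl⟩
      have h1 : s.filter (fun x => ¬ r ∣ x) + ((s.filter (r ∣ ·)).map (· / r)).map (r * ·) = s := by
        have : ((s.filter (r ∣ ·)).map (· / r)).map (r * ·) = s.filter (r ∣ ·) := by
          rw [Multiset.map_map]
          refine (Multiset.map_congr rfl fun x hx => ?_).trans (Multiset.map_id _)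
          exact Nat.mul_div_cancel' (Multiset.mem_filter.1 hx).2
        rw [this, add_comm]
        exact Multiset.filter_add_not _ s
      have h2 := congrArg Multiset.sum h1
      rw [Multiset.sum_add, Multiset.sum_map_mul_left, Multiset.map_id'] at h2
      refine ⟨⟨⟨((s.filter (r ∣ ·)).map (· / r)).sum, ?_⟩,
        ⟨s.filter (fun x => ¬ r ∣ x), fun x hx => ?_, ?_⟩,
        ⟨(s.filter (r ∣ ·)).map (· / r), fun x hx => ⟨?_, trivial⟩, rfl⟩⟩, Subtype.ext h1⟩
      · rw [Nat.lt_succ_iff, Nat.le_div_iff_mul_le hr, mul_comm]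
        omega
      · exact ⟨(hs x (Multiset.mem_filter.1 hx).1).1, (Multiset.mem_filter.1 hx).2⟩
      · simp only
        omega
      · obtain ⟨y, hy, rfl⟩ := Multiset.mem_map.1 hx
        obtain ⟨hy, hd⟩ := Multiset.mem_filter.1 hy
        exact Nat.div_pos (Nat.le_of_dvd (hs y hy).1 hd) hr)).symm

/-- The partitions of `n` into parts not divisible by `r`. -/
def Regular (r n : ℕ) : Type :=
  {f : ℕ → ℕ // IsPartition f ∧ psize f = n ∧ ∀ i, f i ≠ 0 → ¬ r ∣ f i}

/-- Partitions of `n` as multisets of positive integers. -/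
noncomputable def partitionsEquivPartMultisets (n : ℕ) :
    Partitions n ≃ PartMultisets (fun _ => True) n :=
  (Equiv.subtypeEquivRight fun f => by simp).trans (partMultisetsEquiv (fun _ => True) n)

/-- Splitting off the parts divisible by `r`. -/
noncomputable def partitionsEquivRegular {r : ℕ} (hr : 0 < r) (n : ℕ) :
    Partitions n ≃ Σ m : Fin (n / r + 1), Regular r (n - r * m) × Partitions m :=
  ((partitionsEquivPartMultisets n).trans (partMultisetsSplit hr n)).trans <|
  Equiv.sigmaCongrRight fun m => Equiv.prodCongr (partMultisetsEquiv _ _).symm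
    (partitionsEquivPartMultisets m).symm

/-! ### Counting -/

instance finite_partitions (n : ℕ) : Finite (Partitions n) := by
  have : Finite {f : ℕ → ℕ // (∀ i, n ≤ i → f i = 0) ∧ ∀ i, f i ≤ n} := by
    refine Finite.of_injective (β := Fin n → Fin (n + 1))
      (fun f i => ⟨f.1 i, Nat.lt_succ_of_le (f.2.2 i)⟩) fun f g h => Subtype.ext ?_
    funext i
    rcases lt_or_ge i n with hi | hi
    · exact congrArg Fin.val (congrFun h ⟨i, hi⟩)
    · rw [f.2.1 i hi, g.2.1 i hi]
  refine Finite.of_injective (β := {f : ℕ → ℕ // (∀ i, n ≤ i → f i = 0) ∧ ∀ i, f i ≤ n})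
    (fun f => ⟨f.1, fun i hi => f.2.1.eq_zero_of_psize_le (f.2.2.trans_le hi), fun i => ?_⟩)
    fun f g h => Subtype.ext (Subtype.mk.inj h)
  obtain ⟨f, hf, rfl⟩ := f
  change f i ≤ psize f
  rcases lt_or_ge i (psize f) with hi | hi
  · conv_rhs => rw [psize_eq_sum_range fun i hi => hf.eq_zero_of_psize_le hi]
    exact Finset.single_le_sum (fun _ _ => Nat.zero_le _) (Finset.mem_range.2 hi)
  · rw [hf.eq_zero_of_psize_le hi]
    exact Nat.zero_le _

instance finite_emptyZero (r n : ℕ) : Finite (EmptyZero r n) :=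
  Finite.of_injective (β := Partitions n) (fun f => ⟨f.1, f.2.1, f.2.2.1⟩)
    fun _ _ h => Subtype.ext (Subtype.mk.inj h)

instance finite_regular (r n : ℕ) : Finite (Regular r n) :=
  Finite.of_injective (β := Partitions n) (fun f => ⟨f.1, f.2.1, f.2.2.1⟩)
    fun _ _ h => Subtype.ext (Subtype.mk.inj h)

lemma card_partitions_zero_pos : 0 < Nat.card (Partitions 0) := by
  have : Nonempty (Partitions 0) :=
    ⟨⟨fun _ => 0, ⟨fun _ _ _ => le_rfl, 0, fun _ _ => rfl⟩, by simp [psize]⟩⟩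
  exact Nat.card_pos

lemma card_partitions_eq_sum {r n : ℕ} (A : ℕ → Type) [∀ k, Finite (A k)]
    (e : Partitions n ≃ Σ m : Fin (n / r + 1), A (n - r * m) × Partitions m) :
    Nat.card (Partitions n) = ∑ m ∈ Finset.range (n / r),
      Nat.card (A (n - r * (m + 1))) * Nat.card (Partitions (m + 1)) +
      Nat.card (A n) * Nat.card (Partitions 0) := by
  rw [Nat.card_congr e, Nat.card_sigma]
  simp only [Nat.card_prod]
  rw [Fin.sum_univ_eq_sum_range
    (fun m => Nat.card (A (n - r * m)) * Nat.card (Partitions m)) (n / r + 1),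
    Finset.sum_range_succ']
  simp

lemma card_emptyZero_eq_card_regular {r : ℕ} (hr : 0 < r) (n : ℕ) :
    Nat.card (EmptyZero r n) = Nat.card (Regular r n) := by
  induction n using Nat.strong_induction_on with
  | _ n ih =>
    have h1 := card_partitions_eq_sum (EmptyZero r) (partitionsEquivEmptyZero hr n)
    have h2 := card_partitions_eq_sum (Regular r) (partitionsEquivRegular hr n)
    have h3 : ∀ m ∈ Finset.range (n / r),
        Nat.card (EmptyZero r (n - r * (m + 1))) * Nat.card (Partitions (m + 1)) =
        Nat.card (Regular r (n - r * (m + 1))) * Nat.card (Partitions (m + 1)) := by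
      intro m hm
      have hpos : 0 < r * (m + 1) := Nat.mul_pos hr (Nat.succ_pos m)
      have hn : 0 < n := by
        by_contra h0
        simp [show n = 0 by omega] at hm
      rw [ih _ (by omega)]
    rw [h2, Finset.sum_congr rfl h3] at h1
    exact (Nat.eq_of_mul_eq_mul_right card_partitions_zero_pos (Nat.add_left_cancel h1)).symm

/-- The number of partitions of `n` whose `r`-quotient has empty 0-th component equals the
number of partitions of `n` into parts not divisible by `r`. -/
theorem count_partitions_empty_quotient_zero (r : ℕ) (hr : 2 ≤ r) (n : ℕ) :
    Nat.card {f : ℕ → ℕ // IsPartition f ∧ psize f = n ∧ quotP r f 0 = emptyPart} =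
    Nat.card {f : ℕ → ℕ // IsPartition f ∧ psize f = n ∧ ∀ i, f i ≠ 0 → ¬ r ∣ f i} := by
  exact card_emptyZero_eq_card_regular (by omega) n

end RSF
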